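/- Let 1 < p < n, q = p/(p-1), and let f be a smooth compactly supported function on ℝ^n, not identically zero on ℝ^n_+. Then ∫_{(K_f)_+} y_1^{qn−q−n} dy = vol(K_{f,0}) · ∫_0^{q^{1/q} α_f^{1/p}} t^{qn−q−n} (1 − (α_f^{1-q}/q) t^q)^{(n-1)/q} dt, where vol(K_{f,0}) denotes the (n-1)-dimensional volume of the central slice. -/

import Mathlib

open MeasureTheory Real Set
open scoped RealInnerProductSpace ENNReal NNReal Pointwise

noncomputable section

namespace AffineTrace

/-- `ω s = π^(s/2) / Γ(s/2 + 1)` -/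
def w (s : ℝ) : ℝ := Real.pi ^ (s / 2) / Real.Gamma (s / 2 + 1)

/-- the constant `c_{m,p} = (m ω_m)^{1/m} (m ω_m ω_{p-1} / (2 ω_{m+p-2}))^{1/p}` -/
def cc (m : ℕ) (p : ℝ) : ℝ :=
  ((m : ℝ) * w m) ^ ((m : ℝ)⁻¹) *
    ((m : ℝ) * w m * w (p - 1) / (2 * w ((m : ℝ) + p - 2))) ^ p⁻¹

/-- the constant `a_{m,p} = ω_{m+p} / (ω_2 ω_m ω_{p-1})` -/
def aa (m : ℕ) (p : ℝ) : ℝ := w ((m : ℝ) + p) / (w 2 * w m * w (p - 1))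

/-- the open half-space `ℝⁿ₊ = (0,∞) × ℝ^{n-1}` -/
def H (n : ℕ) : Set (ℝ × EuclideanSpace ℝ (Fin (n - 1))) := {y | 0 < y.1}

/-- `∂f/∂t`, the partial derivative in the `t`-variable -/
def dt {n : ℕ} (f : ℝ × EuclideanSpace ℝ (Fin (n - 1)) → ℝ)
    (y : ℝ × EuclideanSpace ℝ (Fin (n - 1))) : ℝ :=
  fderiv ℝ f y (1, 0)

/-- `∇_ξ f = ∇̃f ⬝ ξ`, the directional derivative in the direction `(0, ξ)` -/
def dxi {n : ℕ} (f : ℝ × EuclideanSpace ℝ (Fin (n - 1)) → ℝ)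
    (ξ : EuclideanSpace ℝ (Fin (n - 1))) (y : ℝ × EuclideanSpace ℝ (Fin (n - 1))) : ℝ :=
  fderiv ℝ f y (0, ξ)

/-- `∇̃f`, the gradient in the `x`-variable -/
def gradx {n : ℕ} (f : ℝ × EuclideanSpace ℝ (Fin (n - 1)) → ℝ)
    (y : ℝ × EuclideanSpace ℝ (Fin (n - 1))) : EuclideanSpace ℝ (Fin (n - 1)) :=
  gradient (fun x => f (y.1, x)) y.2

/-- the `L^p` norm (w.r.t. Lebesgue measure) over the half-space `ℝⁿ₊` -/
def lp (n : ℕ) (p : ℝ) (g : ℝ × EuclideanSpace ℝ (Fin (n - 1)) → ℝ) : ℝ :=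
  (∫ y in H n, |g y| ^ p) ^ p⁻¹

/-- the surface measure on the unit sphere `𝕊^{m-1}` of `ℝ^m` -/
def sphMeasure (m : ℕ) : Measure (Metric.sphere (0 : EuclideanSpace ℝ (Fin m)) 1) :=
  (volume : Measure (EuclideanSpace ℝ (Fin m))).toSphere

/-- `Z_p(f) = (∫_{𝕊^{n-2}} ‖∇_ξ f‖_p^{1-n} dξ)^{1/(1-n)}` -/
def Z (n : ℕ) (p : ℝ) (f : ℝ × EuclideanSpace ℝ (Fin (n - 1)) → ℝ) : ℝ :=
  (∫ ξ, lp n p (dxi f (ξ : EuclideanSpace ℝ (Fin (n - 1)))) ^ (1 - (n : ℝ))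
      ∂(sphMeasure (n - 1))) ^ (1 - (n : ℝ))⁻¹

/-- the affine energy `ℰ_p(f) = c_{n-1,p} Z_p(f)` -/
def Ep (n : ℕ) (p : ℝ) (f : ℝ × EuclideanSpace ℝ (Fin (n - 1)) → ℝ) : ℝ :=
  cc (n - 1) p * Z n p f

/-- the boundary trace integral `∫_{∂ℝⁿ₊} |f(0,x)|^r dx` -/
def bdry (n : ℕ) (r : ℝ) (f : ℝ × EuclideanSpace ℝ (Fin (n - 1)) → ℝ) : ℝ :=
  ∫ x : EuclideanSpace ℝ (Fin (n - 1)), |f (0, x)| ^ r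

/-- the duality pairing on `ℝ × ℝ^m` -/
def pairP {m : ℕ} (y z : ℝ × EuclideanSpace ℝ (Fin m)) : ℝ := y.1 * z.1 + ⟪y.2, z.2⟫

/-- the Legendre transform of a function on `ℝ × ℝ^m` -/
def legendreP {m : ℕ} (C : ℝ × EuclideanSpace ℝ (Fin m) → ℝ)
    (y : ℝ × EuclideanSpace ℝ (Fin m)) : ℝ :=
  ⨆ z, (pairP y z - C z)

/-- the Legendre transform of a function on `ℝ^m` -/
def legendreE {m : ℕ} (C : EuclideanSpace ℝ (Fin m) → ℝ) (y : EuclideanSpace ℝ (Fin m)) : ℝ :=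
  ⨆ z, (⟪y, z⟫ - C z)

/-- the `m`-dimensional volume of a subset of `ℝ^m`, as a real number -/
def vol {m : ℕ} (K : Set (EuclideanSpace ℝ (Fin m))) : ℝ := (volume K).toReal

/-- the support function of a subset of `ℝ^m` -/
def suppFn {m : ℕ} (K : Set (EuclideanSpace ℝ (Fin m))) (y : EuclideanSpace ℝ (Fin m)) : ℝ :=
  sSup ((fun z => ⟪y, z⟫) '' K)

/-- the polar body of a subset of `ℝ^m` -/
def polar {m : ℕ} (K : Set (EuclideanSpace ℝ (Fin m))) : Set (EuclideanSpace ℝ (Fin m)) :=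
  {y | ∀ z ∈ K, ⟪y, z⟫ ≤ 1}

/-- the `L_p`-centroid body `Γ_p K` of a convex body `K ⊂ ℝ^m`: the convex body whose
support function is `h(y) = ((a_{m,p} vol K)⁻¹ ∫_K |⟨y,z⟩|^p dz)^{1/p}` -/
def centroid (m : ℕ) (p : ℝ) (K : Set (EuclideanSpace ℝ (Fin m))) :
    Set (EuclideanSpace ℝ (Fin m)) :=
  {x | ∀ y, ⟪x, y⟫ ≤ ((aa m p * vol K)⁻¹ * ∫ z in K, |⟪y, z⟫| ^ p) ^ p⁻¹}

/-- the convex body `L_f = {ξ : ‖∇_ξ f‖_p ≤ 1}` in `ℝ^{n-1}` -/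
def Lbody (n : ℕ) (p : ℝ) (f : ℝ × EuclideanSpace ℝ (Fin (n - 1)) → ℝ) :
    Set (EuclideanSpace ℝ (Fin (n - 1))) :=
  {ξ | lp n p (dxi f ξ) ≤ 1}

/-- the constant `α_f = (p/(p-1)) ‖∂f/∂t‖_p^{-p} Z_p(f)^{1-n}` -/
def alpha (n : ℕ) (p : ℝ) (f : ℝ × EuclideanSpace ℝ (Fin (n - 1)) → ℝ) : ℝ :=
  p / (p - 1) * lp n p (dt f) ^ (-p) * Z n p f ^ (1 - (n : ℝ))

/-- `D_f^*(x) = ∫_{𝕊^{n-2}} ‖∇_ξ f‖_p^{1-n-p} |⟨x,ξ⟩|^p dξ` -/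
def Dstar (n : ℕ) (p : ℝ) (f : ℝ × EuclideanSpace ℝ (Fin (n - 1)) → ℝ)
    (x : EuclideanSpace ℝ (Fin (n - 1))) : ℝ :=
  ∫ ξ, lp n p (dxi f (ξ : EuclideanSpace ℝ (Fin (n - 1)))) ^ (1 - (n : ℝ) - p) *
      |⟪x, (ξ : EuclideanSpace ℝ (Fin (n - 1)))⟫| ^ p ∂(sphMeasure (n - 1))

/-- `C_f^*(t,x) = (α_f/p)|t|^p + D_f^*(x)` -/
def Cstar (n : ℕ) (p : ℝ) (f : ℝ × EuclideanSpace ℝ (Fin (n - 1)) → ℝ)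
    (y : ℝ × EuclideanSpace ℝ (Fin (n - 1))) : ℝ :=
  alpha n p f / p * |y.1| ^ p + Dstar n p f y.2

/-- `C_f`, the Legendre transform of `C_f^*` -/
def Cf (n : ℕ) (p : ℝ) (f : ℝ × EuclideanSpace ℝ (Fin (n - 1)) → ℝ) :
    ℝ × EuclideanSpace ℝ (Fin (n - 1)) → ℝ :=
  legendreP (Cstar n p f)

/-- the convex body `K_f = {y : C_f(y) ≤ 1}` in `ℝⁿ` -/
def Kf (n : ℕ) (p : ℝ) (f : ℝ × EuclideanSpace ℝ (Fin (n - 1)) → ℝ) :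
    Set (ℝ × EuclideanSpace ℝ (Fin (n - 1))) :=
  {y | Cf n p f y ≤ 1}

/-- the slice `K_{f,t} = {x : (t,x) ∈ K_f}` -/
def slice (n : ℕ) (p : ℝ) (f : ℝ × EuclideanSpace ℝ (Fin (n - 1)) → ℝ) (t : ℝ) :
    Set (EuclideanSpace ℝ (Fin (n - 1))) :=
  {x | (t, x) ∈ Kf n p f}

/-- the sharp constant `𝒦_n` of the `L²` Sobolev trace inequality -/
def Kn (n : ℕ) : ℝ :=
  1 / (Real.sqrt Real.pi * ((n : ℝ) - 2)) *
    (Real.Gamma n / (((n : ℝ) - 1) * Real.Gamma (((n : ℝ) - 1) / 2))) ^ (((n : ℝ) - 1)⁻¹)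

/-- the sharp constant `𝒜_{n,p}` of the affine `L^p` Sobolev trace inequality -/
def A (n : ℕ) (p : ℝ) : ℝ :=
  Real.pi ^ (-(p - 1) / 2) * ((p - 1) ^ ((p - 1) / p) / ((n : ℝ) - p)) ^ (p - 1) *
    (Real.Gamma n * Real.Gamma (((n : ℝ) + 1) / 2) /
      (((n : ℝ) - 1) * Real.Gamma (((n : ℝ) - 1) / p) *
        Real.Gamma (((n : ℝ) * (p - 1) + 1) / p))) ^ ((p - 1) / ((n : ℝ) - 1))

theorem pairing_le_of_holderConjugate {p q a : ℝ} (hpq : p.HolderConjugate q) (ha : 0 < a)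
    (t s : ℝ) : t * s ≤ a / p * |s| ^ p + a ^ (1 - q) / q * |t| ^ q := by
  have hp := hpq.pos
  have hq := hpq.symm.pos
  have hqp : q / p = q - 1 := by
    have := hpq.inv_add_inv_eq_one
    field_simp at this ⊢
    linarith
  have h := Real.young_inequality_of_nonneg (a := a ^ p⁻¹ * |s|) (b := a ^ (-p⁻¹) * |t|)
    (by positivity) (by positivity) hpq
  have h1 : a ^ p⁻¹ * |s| * (a ^ (-p⁻¹) * |t|) = |t * s| := by
    rw [abs_mul, rpow_neg ha.le]
    have : a ^ p⁻¹ ≠ 0 := (rpow_pos_of_pos ha _).ne'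
    field_simp
  have h2 : (a ^ p⁻¹ * |s|) ^ p = a * |s| ^ p := by
    rw [mul_rpow (by positivity) (by positivity), ← rpow_mul ha.le, inv_mul_cancel₀ hp.ne',
      rpow_one]
  have h3 : (a ^ (-p⁻¹) * |t|) ^ q = a ^ (1 - q) * |t| ^ q := by
    rw [mul_rpow (by positivity) (by positivity), ← rpow_mul ha.le]
    congr 2
    rw [neg_mul, inv_mul_eq_div, hqp]; ring
  rw [h1, h2, h3] at h
  calc t * s ≤ |t * s| := le_abs_self _
    _ ≤ _ := h
    _ = _ := by ring

theorem exists_pairing_eq_of_holderConjugate {p q a : ℝ} (hpq : p.HolderConjugate q) (ha : 0 < a)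
    {t : ℝ} (ht : 0 ≤ t) : ∃ s : ℝ, t * s = a / p * |s| ^ p + a ^ (1 - q) / q * t ^ q := by
  have hp := hpq.pos
  have hq := hpq.symm.pos
  have hq1 := hpq.symm.lt
  have hinv := hpq.inv_add_inv_eq_one
  have hqp : (q - 1) * p = q := by
    field_simp at hinv
    linarith
  refine ⟨(t / a) ^ (q - 1), ?_⟩
  have h0 : 0 ≤ t / a := by positivity
  rw [abs_of_nonneg (by positivity), ← rpow_mul h0, hqp]
  rcases ht.eq_or_lt with rfl | ht
  · simp [zero_rpow hq.ne']
  · have e1 : t * (t / a) ^ (q - 1) = a ^ (1 - q) * t ^ q := by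
      rw [div_rpow ht.le ha.le, rpow_sub_one ht.ne', show 1 - q = -(q - 1) by ring, rpow_neg ha.le]
      field_simp
    have e2 : a * (t / a) ^ q = a ^ (1 - q) * t ^ q := by
      rw [div_rpow ht.le ha.le, rpow_sub ha, rpow_one]
      ring
    calc _ = a ^ (1 - q) * t ^ q * (p⁻¹ + q⁻¹) := by rw [hinv, e1, mul_one]
      _ = a * (t / a) ^ q * p⁻¹ + a ^ (1 - q) * t ^ q * q⁻¹ := by rw [e2]; ring
      _ = _ := by ring

/-- The sublevel set `{x : D*(x) ≤ r}` of the Legendre transform of `D`, written without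
suprema. -/
def legendreSublevel {m : ℕ} (D : EuclideanSpace ℝ (Fin m) → ℝ) (r : ℝ) :
    Set (EuclideanSpace ℝ (Fin m)) :=
  {x | ∀ z, ⟪x, z⟫ - D z ≤ r}

theorem legendreSublevel_eq_empty {m : ℕ} {D : EuclideanSpace ℝ (Fin m) → ℝ} (h0 : D 0 = 0)
    {r : ℝ} (hr : r < 0) : legendreSublevel D r = ∅ := by
  ext x
  simp only [legendreSublevel, mem_ofPred_eq, mem_empty_iff_false, iff_false, not_forall]
  exact ⟨0, by simpa [h0] using hr⟩

theorem legendreSublevel_eq_smul {m : ℕ} {D : EuclideanSpace ℝ (Fin m) → ℝ} {p q : ℝ}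
    (hpq : p.HolderConjugate q) (hD : ∀ r > 0, ∀ z, D (r • z) = r ^ p * D z) {r : ℝ} (hr : 0 < r) :
    legendreSublevel D r = r ^ q⁻¹ • legendreSublevel D 1 := by
  have hl : 0 < r ^ q⁻¹ := rpow_pos_of_pos hr _
  have hm : 0 < r ^ p⁻¹ := rpow_pos_of_pos hr _
  have hlm : r ^ p⁻¹ * r ^ q⁻¹ = r := by
    rw [← rpow_add hr, hpq.inv_add_inv_eq_one, rpow_one]
  have hmp : (r ^ p⁻¹) ^ p = r := by
    rw [← rpow_mul hr.le, inv_mul_cancel₀ hpq.pos.ne', rpow_one]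
  have key : ∀ x z, ⟪x, r ^ p⁻¹ • z⟫ - D (r ^ p⁻¹ • z) =
      r * (⟪(r ^ q⁻¹)⁻¹ • x, z⟫ - D z) := by
    intro x z
    rw [hD _ hm, hmp, real_inner_smul_right, real_inner_smul_left]
    have : r * (r ^ q⁻¹)⁻¹ = r ^ p⁻¹ := by
      rw [← div_eq_mul_inv, div_eq_iff hl.ne', hlm]
    rw [mul_sub, ← mul_assoc, this]
  ext x
  rw [mem_smul_set_iff_inv_smul_mem₀ hl.ne']
  simp only [legendreSublevel, mem_ofPred_eq]
  constructor
  · intro h z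
    have := h (r ^ p⁻¹ • z)
    rw [key] at this
    exact le_of_mul_le_mul_left (by simpa using this) hr
  · intro h z
    have := key x ((r ^ p⁻¹)⁻¹ • z)
    rw [smul_inv_smul₀ hm.ne'] at this
    rw [this]
    simpa using mul_le_mul_of_nonneg_left (h ((r ^ p⁻¹)⁻¹ • z)) hr.le

theorem volume_legendreSublevel {m : ℕ} {D : EuclideanSpace ℝ (Fin m) → ℝ} {p q : ℝ}
    (hpq : p.HolderConjugate q) (hD : ∀ r > 0, ∀ z, D (r • z) = r ^ p * D z) {r : ℝ} (hr : 0 < r) :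
    volume (legendreSublevel D r) =
      ENNReal.ofReal (r ^ ((m : ℝ) / q)) * volume (legendreSublevel D 1) := by
  rw [legendreSublevel_eq_smul hpq hD hr, Measure.addHaar_smul]
  congr 2
  rw [abs_of_nonneg (by positivity), finrank_euclideanSpace_fin, ← rpow_natCast, ← rpow_mul hr.le]
  congr 1
  ring

section LegendreP

variable {m : ℕ} {p q a : ℝ} {D : EuclideanSpace ℝ (Fin m) → ℝ}

theorem legendreP_le_iff {C : ℝ × EuclideanSpace ℝ (Fin m) → ℝ}
    {y : ℝ × EuclideanSpace ℝ (Fin m)} (hC : BddAbove (range fun z => pairP y z - C z)) {r : ℝ} :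
    legendreP C y ≤ r ↔ ∀ z, pairP y z - C z ≤ r :=
  ciSup_le_iff hC

theorem bddAbove_pairP_sub (hpq : p.HolderConjugate q) (ha : 0 < a)
    (hD : ∃ c > 0, ∀ z, c * ‖z‖ ^ p ≤ D z) (y : ℝ × EuclideanSpace ℝ (Fin m)) :
    BddAbove (range fun z => pairP y z - (a / p * |z.1| ^ p + D z.2)) := by
  obtain ⟨c, hc, hD⟩ := hD
  have hp := hpq.pos
  refine ⟨a ^ (1 - q) / q * |y.1| ^ q + (c * p) ^ (1 - q) / q * |‖y.2‖| ^ q, ?_⟩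
  rintro _ ⟨z, rfl⟩
  have h1 := pairing_le_of_holderConjugate hpq ha y.1 z.1
  have h2 := pairing_le_of_holderConjugate hpq (mul_pos hc hp) ‖y.2‖ ‖z.2‖
  rw [mul_div_cancel_right₀ _ hp.ne', abs_of_nonneg (norm_nonneg z.2)] at h2
  have h3 := real_inner_le_norm y.2 z.2
  have h4 := hD z.2
  simp only [pairP]
  linarith

theorem isClosed_legendreP_le (hpq : p.HolderConjugate q) (ha : 0 < a)
    (hD : ∃ c > 0, ∀ z, c * ‖z‖ ^ p ≤ D z) (r : ℝ) :
    IsClosed {y : ℝ × EuclideanSpace ℝ (Fin m) |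
      legendreP (fun z => a / p * |z.1| ^ p + D z.2) y ≤ r} := by
  simp only [fun y => legendreP_le_iff (r := r) (bddAbove_pairP_sub hpq ha hD y), ofPred_forall]
  refine isClosed_iInter fun z => isClosed_le ?_ continuous_const
  unfold pairP
  fun_prop

theorem legendreP_le_iff_mem_legendreSublevel (hpq : p.HolderConjugate q) (ha : 0 < a)
    (hD : ∃ c > 0, ∀ z, c * ‖z‖ ^ p ≤ D z) (r : ℝ) {t : ℝ} (ht : 0 ≤ t)
    (x : EuclideanSpace ℝ (Fin m)) :
    legendreP (fun z => a / p * |z.1| ^ p + D z.2) (t, x) ≤ r ↔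
      x ∈ legendreSublevel D (r - a ^ (1 - q) / q * t ^ q) := by
  rw [legendreP_le_iff (bddAbove_pairP_sub hpq ha hD _)]
  simp only [pairP, legendreSublevel, mem_ofPred_eq, Prod.forall]
  constructor
  · intro h z
    obtain ⟨s, hs⟩ := exists_pairing_eq_of_holderConjugate hpq ha ht
    have := h s z
    linarith
  · intro h s z
    have h1 := pairing_le_of_holderConjugate hpq ha t s
    rw [abs_of_nonneg ht] at h1
    have := h z
    linarith

/-- Fubini over the slices of a sublevel set of the Legendre transform of `(a/p)|t|^p + D(x)`. -/
theorem integral_legendreP_le_eq (hpq : p.HolderConjugate q) (ha : 0 < a)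
    (hD : ∃ c > 0, ∀ z, c * ‖z‖ ^ p ≤ D z) (h0 : D 0 = 0)
    (hDh : ∀ r > 0, ∀ z, D (r • z) = r ^ p * D z) (e : ℝ) :
    ∫ y in {y : ℝ × EuclideanSpace ℝ (Fin m) |
        legendreP (fun z => a / p * |z.1| ^ p + D z.2) y ≤ 1} ∩ {y | 0 < y.1}, y.1 ^ e =
      vol {x | legendreP (fun z => a / p * |z.1| ^ p + D z.2) ((0 : ℝ), x) ≤ 1} *
        ∫ t in (0 : ℝ)..(q ^ q⁻¹ * a ^ p⁻¹),
          t ^ e * (1 - a ^ (1 - q) / q * t ^ q) ^ ((m : ℝ) / q) := by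
  have hp := hpq.pos
  have hq := hpq.symm.pos
  set K := {y : ℝ × EuclideanSpace ℝ (Fin m) |
        legendreP (fun z => a / p * |z.1| ^ p + D z.2) y ≤ 1}
  set T := q ^ q⁻¹ * a ^ p⁻¹ with hT
  set b := a ^ (1 - q) / q with hb
  have hb0 : 0 < b := by positivity
  have hT0 : 0 < T := by positivity
  have hbT : b * T ^ q = 1 := by
    have h1 : p⁻¹ * q = q - 1 := by
      have := hpq.inv_add_inv_eq_one
      field_simp at this ⊢
      linarith
    rw [hT, mul_rpow (by positivity) (by positivity), ← rpow_mul hq.le, ← rpow_mul ha.le,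
      inv_mul_cancel₀ hq.ne', rpow_one, h1, hb, show 1 - q = -(q - 1) by ring, rpow_neg ha.le]
    have : a ^ (q - 1) ≠ 0 := (rpow_pos_of_pos ha _).ne'
    field_simp
  have hKm : MeasurableSet K := (isClosed_legendreP_le hpq ha hD 1).measurableSet
  have hHm : MeasurableSet {y : ℝ × EuclideanSpace ℝ (Fin m) | 0 < y.1} :=
    measurableSet_lt measurable_const measurable_fst
  have hslice : ∀ t ≥ 0, {x | (t, x) ∈ K} = legendreSublevel D (1 - b * t ^ q) := by
    intro t ht
    ext x
    exact legendreP_le_iff_mem_legendreSublevel hpq ha hD 1 ht x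
  have hslice0 : {x | ((0 : ℝ), x) ∈ K} = legendreSublevel D 1 := by
    rw [hslice 0 le_rfl, zero_rpow hq.ne']; simp
  have hpos : ∀ t ∈ Ioo 0 T, 0 < 1 - b * t ^ q := by
    intro t ht
    have : t ^ q < T ^ q := rpow_lt_rpow ht.1.le ht.2 hq
    nlinarith
  have hneg : ∀ t, T < t → 1 - b * t ^ q < 0 := by
    intro t ht
    have : T ^ q < t ^ q := rpow_lt_rpow hT0.le ht hq
    nlinarith
  have hL : ∫ y in K ∩ {y | 0 < y.1}, y.1 ^ e =
      (∫⁻ t in Ioi (0 : ℝ), ENNReal.ofReal (t ^ e) * volume {x | (t, x) ∈ K}).toReal := by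
    rw [integral_eq_lintegral_of_nonneg_ae
      (ae_restrict_of_forall_mem (hKm.inter hHm) fun y hy => rpow_nonneg (le_of_lt hy.2) _)
      (Measurable.aestronglyMeasurable (by fun_prop)),
      ← lintegral_indicator (hKm.inter hHm), Measure.volume_eq_prod, lintegral_prod _
      ((Measurable.indicator (by fun_prop) (hKm.inter hHm)).aemeasurable),
      ← lintegral_indicator measurableSet_Ioi]
    congr 2
    ext t
    by_cases ht : 0 < t
    · have : ∀ x, (K ∩ {y | 0 < y.1}).indicator (fun y => ENNReal.ofReal (y.1 ^ e)) (t, x) =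
          {x | (t, x) ∈ K}.indicator (fun _ => ENNReal.ofReal (t ^ e)) x := by
        intro x
        simp [indicator, ht]
      simp_rw [this]
      rw [lintegral_indicator (show MeasurableSet {x | (t, x) ∈ K} from measurable_prodMk_left hKm),
        setLIntegral_const,
        indicator_of_mem (by exact ht)]
    · simp [indicator, ht]
  have hR : ∫ t in (0 : ℝ)..T, t ^ e * (1 - b * t ^ q) ^ ((m : ℝ) / q) =
      (∫⁻ t in Ioo 0 T, ENNReal.ofReal (t ^ e * (1 - b * t ^ q) ^ ((m : ℝ) / q))).toReal := by
    rw [intervalIntegral.integral_of_le hT0.le, integral_Ioc_eq_integral_Ioo,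
      integral_eq_lintegral_of_nonneg_ae
      (ae_restrict_of_forall_mem measurableSet_Ioo fun t ht =>
        mul_nonneg (rpow_nonneg ht.1.le _) (rpow_nonneg (hpos t ht).le _))
      (Measurable.aestronglyMeasurable (by fun_prop))]
  rw [hL, hR, show {x | legendreP (fun z => a / p * |z.1| ^ p + D z.2) ((0 : ℝ), x) ≤ 1} =
    legendreSublevel D 1 from hslice0, vol, ← ENNReal.toReal_mul, ← lintegral_const_mul _
    (by fun_prop), ← lintegral_indicator measurableSet_Ioo, ← lintegral_indicator measurableSet_Ioi]
  congr 1
  refine lintegral_congr_ae ?_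
  filter_upwards [compl_mem_ae_iff.2 (measure_singleton (μ := volume) T)] with t ht
  rcases le_or_gt t 0 with h | h
  · rw [indicator_of_notMem (by simpa using h), indicator_of_notMem (fun h' => h.not_gt h'.1)]
  rw [indicator_of_mem (by exact h), hslice t h.le]
  rcases lt_or_gt_of_ne (show t ≠ T from ht) with h' | h'
  · rw [indicator_of_mem (by exact ⟨h, h'⟩), volume_legendreSublevel hpq hDh (hpos t ⟨h, h'⟩),
      ENNReal.ofReal_mul (rpow_nonneg h.le _)]
    ring
  · rw [indicator_of_notMem (fun h'' => h'.not_gt h''.2), legendreSublevel_eq_empty h0 (hneg t h')]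
    simp

end LegendreP

instance isFiniteMeasure_sphMeasure (m : ℕ) : IsFiniteMeasure (sphMeasure m) := by
  unfold sphMeasure; infer_instance

instance isOpenPosMeasure_sphMeasure (m : ℕ) : (sphMeasure m).IsOpenPosMeasure := by
  unfold sphMeasure; infer_instance

section Energy

variable {n : ℕ} {p : ℝ} {f : ℝ × EuclideanSpace ℝ (Fin (n - 1)) → ℝ}

theorem exists_fderiv_ne_zero (hf : Differentiable ℝ f) (hfc : HasCompactSupport f)
    (hf0 : ∃ y ∈ H n, f y ≠ 0) {v : ℝ × EuclideanSpace ℝ (Fin (n - 1))} (hv : v ≠ 0)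
    (hv1 : 0 ≤ v.1) : ∃ y ∈ H n, fderiv ℝ f y v ≠ 0 := by
  obtain ⟨y, hy, hfy⟩ := hf0
  obtain ⟨B, hB⟩ := hfc.isCompact.isBounded.exists_norm_le
  have hv' : 0 < ‖v‖ := norm_pos_iff.2 hv
  set R := (|B| + ‖y‖ + 1) / ‖v‖ with hR
  have hR0 : 0 < R := by positivity
  have hfR : f (y + R • v) = 0 := by
    refine image_eq_zero_of_notMem_tsupport fun h => ?_
    have h1 := hB _ h
    have h2 : ‖R • v‖ ≤ ‖y + R • v‖ + ‖y‖ := by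
      simpa using norm_sub_le (y + R • v) y
    rw [norm_smul, Real.norm_of_nonneg hR0.le, hR, div_mul_cancel₀ _ hv'.ne'] at h2
    linarith [le_abs_self B]
  have hd : ∀ r : ℝ, HasDerivAt (fun r : ℝ => f (y + r • v)) (fderiv ℝ f (y + r • v) v) r := by
    intro r
    have h1 : HasDerivAt (fun r : ℝ => y + r • v) v r := by
      simpa using ((hasDerivAt_id r).smul_const v).const_add y
    exact (hf _).hasFDerivAt.comp_hasDerivAt r h1
  obtain ⟨r, hr, hr'⟩ := exists_hasDerivAt_eq_slope (fun r : ℝ => f (y + r • v)) _ hR0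
    (fun r _ => (hd r).continuousAt.continuousWithinAt) (fun r _ => hd r)
  refine ⟨y + r • v, ?_, ?_⟩
  · have : 0 ≤ r * v.1 := mul_nonneg hr.1.le hv1
    have hy' : 0 < y.1 := hy
    show 0 < y.1 + r * v.1
    linarith
  · rw [hr', hfR]
    simp [hfy, hR0.ne']

theorem isOpen_H : IsOpen (H n) := isOpen_lt continuous_const continuous_fst

theorem continuous_uncurry_fderiv_rpow (hf : ContDiff ℝ (⊤ : ℕ∞) f) (hp : 0 < p) :
    Continuous (Function.uncurry fun (v y : ℝ × EuclideanSpace ℝ (Fin (n - 1))) =>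
      |fderiv ℝ f y v| ^ p) := by
  have h : Continuous (fderiv ℝ f) := hf.continuous_fderiv (by simp)
  refine Continuous.rpow_const (Continuous.abs ?_) fun _ => Or.inr hp.le
  exact (h.comp continuous_snd).clm_apply continuous_fst

theorem continuous_lp_fderiv (hf : ContDiff ℝ (⊤ : ℕ∞) f) (hfc : HasCompactSupport f)
    (hp : 0 < p) : Continuous fun v => lp n p (fun y => fderiv ℝ f y v) := by
  have h := continuous_parametric_integral_of_continuous (μ := volume.restrict (H n))
    (continuous_uncurry_fderiv_rpow hf hp) hfc.isCompact
  unfold lp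
  refine Continuous.rpow_const (h.congr fun v => ?_) fun _ => Or.inr (by positivity)
  refine setIntegral_eq_integral_of_forall_compl_eq_zero fun y hy => ?_
  rw [image_eq_zero_of_notMem_tsupport fun h => hy (tsupport_fderiv_subset ℝ h)]
  simp [zero_rpow hp.ne']

theorem lp_fderiv_pos (hf : ContDiff ℝ (⊤ : ℕ∞) f) (hfc : HasCompactSupport f)
    (hf0 : ∃ y ∈ H n, f y ≠ 0) (hp : 0 < p) {v : ℝ × EuclideanSpace ℝ (Fin (n - 1))} (hv : v ≠ 0)
    (hv1 : 0 ≤ v.1) : 0 < lp n p (fun y => fderiv ℝ f y v) := by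
  have hc : Continuous fun y => |fderiv ℝ f y v| ^ p :=
    (continuous_uncurry_fderiv_rpow hf hp).uncurry_left v
  have hcs : HasCompactSupport fun y => |fderiv ℝ f y v| ^ p :=
    (hfc.fderiv_apply ℝ v).comp_left (g := fun r : ℝ => |r| ^ p) (by simp [zero_rpow hp.ne'])
  refine rpow_pos_of_pos ?_ _
  rw [setIntegral_pos_iff_support_of_nonneg_ae (Filter.Eventually.of_forall fun y => by
    simp only [Pi.zero_apply]; positivity)
    (hc.integrable_of_hasCompactSupport hcs).integrableOn]
  obtain ⟨y, hy, hy'⟩ := exists_fderiv_ne_zero (hf.differentiable (by simp)) hfc hf0 hv hv1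
  refine (hc.isOpen_support.inter isOpen_H).measure_pos _ ⟨y, ?_, hy⟩
  exact (rpow_pos_of_pos (abs_pos.2 hy') p).ne'

theorem continuous_lp_dxi (hf : ContDiff ℝ (⊤ : ℕ∞) f) (hfc : HasCompactSupport f)
    (hp : 0 < p) : Continuous fun ξ : EuclideanSpace ℝ (Fin (n - 1)) => lp n p (dxi f ξ) :=
  (continuous_lp_fderiv hf hfc hp).comp (by fun_prop : Continuous fun ξ => ((0 : ℝ), ξ))

theorem lp_dxi_pos (hf : ContDiff ℝ (⊤ : ℕ∞) f) (hfc : HasCompactSupport f)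
    (hf0 : ∃ y ∈ H n, f y ≠ 0) (hp : 0 < p) {ξ : EuclideanSpace ℝ (Fin (n - 1))} (hξ : ξ ≠ 0) :
    0 < lp n p (dxi f ξ) :=
  lp_fderiv_pos hf hfc hf0 hp (by simpa using hξ) le_rfl

theorem continuous_lp_dxi_rpow (hf : ContDiff ℝ (⊤ : ℕ∞) f) (hfc : HasCompactSupport f)
    (hf0 : ∃ y ∈ H n, f y ≠ 0) (hp : 0 < p) (s : ℝ) :
    Continuous fun ξ : Metric.sphere (0 : EuclideanSpace ℝ (Fin (n - 1))) 1 =>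
      lp n p (dxi f (ξ : EuclideanSpace ℝ (Fin (n - 1)))) ^ s :=
  ((continuous_lp_dxi hf hfc hp).comp continuous_subtype_val).rpow_const fun ξ =>
    Or.inl (lp_dxi_pos hf hfc hf0 hp (ne_zero_of_mem_unit_sphere ξ)).ne'

theorem alpha_pos (hn : 2 ≤ n) (hf : ContDiff ℝ (⊤ : ℕ∞) f) (hfc : HasCompactSupport f)
    (hf0 : ∃ y ∈ H n, f y ≠ 0) (hp : 1 < p) : 0 < alpha n p f := by
  have hp0 : 0 < p := by linarith
  have : NeZero (n - 1) := ⟨by omega⟩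
  have hdt : 0 < lp n p (dt f) := lp_fderiv_pos hf hfc hf0 hp0 (by simp) zero_le_one
  obtain ⟨ξ, hξ⟩ := NormedSpace.sphere_nonempty (x := (0 : EuclideanSpace ℝ (Fin (n - 1)))).2
    zero_le_one
  have hZ : 0 < Z n p f := by
    refine rpow_pos_of_pos ?_ _
    refine (continuous_lp_dxi_rpow hf hfc hf0 hp0 _).integral_pos_of_hasCompactSupport_nonneg_nonzero
      (HasCompactSupport.of_compactSpace _) (fun ζ => ?_) (x := ⟨ξ, hξ⟩) ?_
    · exact (rpow_pos_of_pos (lp_dxi_pos hf hfc hf0 hp0 (ne_zero_of_mem_unit_sphere ζ)) _).le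
    · exact (rpow_pos_of_pos
        (lp_dxi_pos hf hfc hf0 hp0 (ne_zero_of_mem_unit_sphere ⟨ξ, hξ⟩)) _).ne'
  have hp1 : 0 < p - 1 := by linarith
  unfold alpha
  positivity

theorem Dstar_zero (hp : 0 < p) : Dstar n p f 0 = 0 := by
  simp [Dstar, zero_rpow hp.ne']

theorem Dstar_smul {r : ℝ} (hr : 0 < r) (x : EuclideanSpace ℝ (Fin (n - 1))) :
    Dstar n p f (r • x) = r ^ p * Dstar n p f x := by
  unfold Dstar
  rw [← integral_const_mul]
  congr 1
  ext ξ
  rw [real_inner_smul_left, abs_mul, abs_of_pos hr, mul_rpow hr.le (abs_nonneg _)]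
  ring

theorem continuous_uncurry_Dstar_integrand (hf : ContDiff ℝ (⊤ : ℕ∞) f)
    (hfc : HasCompactSupport f) (hf0 : ∃ y ∈ H n, f y ≠ 0) (hp : 0 < p) :
    Continuous (Function.uncurry fun (x : EuclideanSpace ℝ (Fin (n - 1)))
      (ξ : Metric.sphere (0 : EuclideanSpace ℝ (Fin (n - 1))) 1) =>
      lp n p (dxi f (ξ : EuclideanSpace ℝ (Fin (n - 1)))) ^ (1 - (n : ℝ) - p) *
        |⟪x, (ξ : EuclideanSpace ℝ (Fin (n - 1)))⟫| ^ p) := by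
  refine ((continuous_lp_dxi_rpow hf hfc hf0 hp _).comp continuous_snd).mul ?_
  exact Continuous.rpow_const (by fun_prop) fun _ => Or.inr hp.le

theorem continuous_Dstar (hf : ContDiff ℝ (⊤ : ℕ∞) f) (hfc : HasCompactSupport f)
    (hf0 : ∃ y ∈ H n, f y ≠ 0) (hp : 0 < p) : Continuous (Dstar n p f) := by
  have h := continuous_parametric_integral_of_continuous (μ := sphMeasure (n - 1))
    (continuous_uncurry_Dstar_integrand hf hfc hf0 hp) isCompact_univ
  simp only [Measure.restrict_univ] at h
  exact h

theorem Dstar_pos (hf : ContDiff ℝ (⊤ : ℕ∞) f) (hfc : HasCompactSupport f)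
    (hf0 : ∃ y ∈ H n, f y ≠ 0) (hp : 0 < p) {x : EuclideanSpace ℝ (Fin (n - 1))}
    (hx : ‖x‖ = 1) : 0 < Dstar n p f x := by
  have hc : Continuous fun ξ : Metric.sphere (0 : EuclideanSpace ℝ (Fin (n - 1))) 1 =>
      lp n p (dxi f (ξ : EuclideanSpace ℝ (Fin (n - 1)))) ^ (1 - (n : ℝ) - p) *
        |⟪x, (ξ : EuclideanSpace ℝ (Fin (n - 1)))⟫| ^ p :=
    (continuous_uncurry_Dstar_integrand hf hfc hf0 hp).uncurry_left x
  have hpos := fun ξ : Metric.sphere (0 : EuclideanSpace ℝ (Fin (n - 1))) 1 =>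
    rpow_pos_of_pos (lp_dxi_pos hf hfc hf0 hp (ne_zero_of_mem_unit_sphere ξ)) (1 - (n : ℝ) - p)
  refine hc.integral_pos_of_hasCompactSupport_nonneg_nonzero
    (HasCompactSupport.of_compactSpace _) (fun ξ => ?_) (x := ⟨x, by simpa using hx⟩) ?_
  · exact mul_nonneg (hpos ξ).le (by positivity)
  · simpa [real_inner_self_eq_norm_sq, hx] using (hpos ⟨x, by simpa using hx⟩).ne'

theorem exists_mul_norm_rpow_le_Dstar (hn : 2 ≤ n) (hf : ContDiff ℝ (⊤ : ℕ∞) f)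
    (hfc : HasCompactSupport f) (hf0 : ∃ y ∈ H n, f y ≠ 0) (hp : 0 < p) :
    ∃ c > 0, ∀ x, c * ‖x‖ ^ p ≤ Dstar n p f x := by
  have : NeZero (n - 1) := ⟨by omega⟩
  obtain ⟨ξ, hξ, hmin⟩ := (isCompact_sphere (0 : EuclideanSpace ℝ (Fin (n - 1))) 1).exists_isMinOn
    (NormedSpace.sphere_nonempty.2 zero_le_one) (continuous_Dstar hf hfc hf0 hp).continuousOn
  refine ⟨_, Dstar_pos hf hfc hf0 hp (by simpa using hξ), fun x => ?_⟩
  rcases eq_or_ne x 0 with rfl | hx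
  · simp [Dstar_zero hp, zero_rpow hp.ne']
  have hx' : 0 < ‖x‖ := norm_pos_iff.2 hx
  have h := hmin (show ‖x‖⁻¹ • x ∈ Metric.sphere 0 1 by simp [norm_smul, hx'.ne'])
  have h2 : Dstar n p f x = ‖x‖ ^ p * Dstar n p f (‖x‖⁻¹ • x) := by
    rw [← Dstar_smul hx', smul_inv_smul₀ hx'.ne']
  rw [h2, mul_comm]
  exact mul_le_mul_of_nonneg_left h (by positivity)

end Energy

/-- Fubini over the slices of `K_f`:
`∫_{(K_f)_+} y₁^{qn−q−n} dy = vol(K_{f,0}) ∫₀^{q^{1/q} α_f^{1/p}} t^{qn−q−n}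
(1 − (α_f^{1-q}/q) t^q)^{(n-1)/q} dt`. -/
theorem integral_Kf_eq_slice_integral (n : ℕ) (hn : 3 ≤ n) (p q : ℝ) (hp : 1 < p)
    (hpn : p < n) (hq : q = p / (p - 1))
    (f : ℝ × EuclideanSpace ℝ (Fin (n - 1)) → ℝ) (hf : ContDiff ℝ (⊤ : ℕ∞) f)
    (hfc : HasCompactSupport f) (hf0 : ∃ y ∈ H n, f y ≠ 0) :
    ∫ y in (Kf n p f ∩ H n), y.1 ^ (q * (n : ℝ) - q - (n : ℝ)) =
      vol (slice n p f 0) *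
        ∫ t in (0 : ℝ)..(q ^ q⁻¹ * alpha n p f ^ p⁻¹),
          t ^ (q * (n : ℝ) - q - (n : ℝ)) *
            (1 - alpha n p f ^ (1 - q) / q * t ^ q) ^ (((n : ℝ) - 1) / q) := by
  have hD := exists_mul_norm_rpow_le_Dstar (by omega) hf hfc hf0 (by linarith : 0 < p)
  have h := integral_legendreP_le_eq ((holderConjugate_iff_eq_conjExponent hp).2 hq)
    (alpha_pos (by omega) hf hfc hf0 hp) hD (Dstar_zero (by linarith))
    (fun r hr z => Dstar_smul hr z) (q * (n : ℝ) - q - (n : ℝ))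
  rw [Nat.cast_sub (by omega), Nat.cast_one] at h
  exact h

end AffineTrace
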